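/- Set A_q(z) = Σ_{j=1}^k ⟨ᵀg^(q), (column j of ᵀV^Λ)⟩ · ξ^(j)(z) (in the paper's notation, A_q(z) = Σ_ν ᵀQ_q^(ν) ξ^(ν)(z)). Then for every z ∈ ℂ^k such that z_q ∉ ℤ for all q: Π_{q=1}^k Γ(z_q) · Γ(A_q(z)) · sin(π A_q(z)) = π^k, where Γ is the complex Gamma function. Consequently Π_{q=1}^k Γ(z_q) · Π_{j∈I_Λ} Γ(ξ_j(z)) = π^k · Π_{j∈I_Λ} Γ(ξ_j(z)) / Π_{q=1}^k [Γ(A_q(z)) · sin(π A_q(z))]; since by condition (3.10)ᵀ the factors Γ(ξ_j(z)), j ∈ I_Λ, are exactly the factors Γ(ᵀg_j^(ν) ξ^(ν)(z)), this is formula (3.12) of Theorem 3.1: the Mellin transform M^0_{0,γ}(z) of the period integral of the Calabi–Yau complete intersection equals Π_ν Π_j Γ(ᵀg_j^(ν) ξ^(ν)(z)) / Π_q Γ(Σ_ν ᵀQ_q^(ν) ξ^(ν)(z)) up to a Δ-periodic factor. [Theorem 3.1] -/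

import Mathlib

open Matrix Finset

/-- Index of the monomial rows `a^{ν-1}+q`, `1 ≤ q ≤ τ_ν` (the set `I_Λ`). -/
abbrev MonIdx (k : ℕ) (τ : Fin k → ℕ) := Σ ν : Fin k, Fin (τ ν)

/-- Row index of the Cayley matrix `𝖫`: the monomial rows together with, for every
`ν`, the three rows `a^ν-2`, `a^ν-1`, `a^ν` (encoded as `(ν,0)`, `(ν,1)`, `(ν,2)`). -/
abbrev RowIdx (k : ℕ) (τ : Fin k → ℕ) := MonIdx k τ ⊕ (Fin k × Fin 3)

/-- Column (variable) index: `n` x-coordinates, `2k` y-coordinates (the y-coordinates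
`2ν-1`, `2ν` are encoded as `(ν,0)`, `(ν,1)`), and `k` s-coordinates. -/
abbrev ColIdx (k n : ℕ) := Fin n ⊕ ((Fin k × Fin 2) ⊕ Fin k)

/-- The exponent matrix `𝖫` of the Cayley polynomial `F(x,s,y)`. -/
noncomputable def cayley (k n : ℕ) (τ : Fin k → ℕ) (v : (ν : Fin k) → Fin (τ ν) → Fin n → ℤ)
    (I : Fin k → Finset (Fin n)) : Matrix (RowIdx k τ) (ColIdx k n) ℂ :=
  fun r c =>
    match r, c with
    | Sum.inl ⟨ν, q⟩, Sum.inl j => (v ν q j : ℂ)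
    | Sum.inl ⟨ν, _⟩, Sum.inr (Sum.inl (μ, t)) => if μ = ν ∧ t = 0 then 1 else 0
    | Sum.inl _, Sum.inr (Sum.inr _) => 0
    | Sum.inr (ν, r), Sum.inl j => if r = 1 ∧ j ∈ I ν then 1 else 0
    | Sum.inr (ν, r), Sum.inr (Sum.inl (μ, t)) =>
        if μ = ν ∧ ((r = 0 ∧ t = 0) ∨ (r ≠ 0 ∧ t = 1)) then 1 else 0
    | Sum.inr (ν, r), Sum.inr (Sum.inr q) => if r = 0 ∧ q = ν then 1 else 0

/-- The linear functions `ξ_a(z) = Σ_j w_j^(a) + Σ_r q_r^(a) + Σ_q p_q^(a) z_q`,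
read off from the columns of `𝖫⁻¹`. -/
noncomputable def xiFun {k n : ℕ} {τ : Fin k → ℕ} (Linv : Matrix (ColIdx k n) (RowIdx k τ) ℂ)
    (z : Fin k → ℂ) (a : RowIdx k τ) : ℂ :=
  (∑ j : Fin n, Linv (Sum.inl j) a) + (∑ r : Fin k × Fin 2, Linv (Sum.inr (Sum.inl r)) a)
    + ∑ q : Fin k, Linv (Sum.inr (Sum.inr q)) a * z q

/-- The n×n matrix `𝖫_Λ` whose rows (indexed by the monomial rows, i.e. in the order
`v^(1)_1, …, v^(1)_{τ_1}, …, v^(k)_{τ_k}`) are the exponent vectors. -/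
noncomputable def lamMat (k n : ℕ) (τ : Fin k → ℕ)
    (v : (ν : Fin k) → Fin (τ ν) → Fin n → ℤ) : Matrix (MonIdx k τ) (Fin n) ℂ :=
  fun σ j => (v σ.1 σ.2 j : ℂ)

/-- The n×k matrix `V^Λ` whose q-th column is the indicator vector `v^(q)_{τ_q+1}` of `I^(q)`. -/
noncomputable def vLam (k n : ℕ) (I : Fin k → Finset (Fin n)) :
    Matrix (Fin n) (Fin k) ℂ :=
  fun j q => if j ∈ I q then 1 else 0

/-- The right-hand side `c(z)` of the linear system `ᵗ𝖫 · Ξ = c(z)`. -/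
def systemRhs {k n : ℕ} (z : Fin k → ℂ) : ColIdx k n → ℂ
  | Sum.inl _ => 1
  | Sum.inr (Sum.inl _) => 1
  | Sum.inr (Sum.inr q) => z q

lemma xiFun_eq_vecMul {k n : ℕ} {τ : Fin k → ℕ} (Linv : Matrix (ColIdx k n) (RowIdx k τ) ℂ)
    (z : Fin k → ℂ) : xiFun Linv z = systemRhs z ᵥ* Linv := by
  funext a
  simp only [xiFun, Matrix.vecMul, dotProduct, Fintype.sum_sum_type, systemRhs, one_mul, add_assoc]
  simp only [mul_comm]

lemma xiFun_vecMul_cayley {k n : ℕ} {τ : Fin k → ℕ} {v : (ν : Fin k) → Fin (τ ν) → Fin n → ℤ}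
    {I : Fin k → Finset (Fin n)} {Linv : Matrix (ColIdx k n) (RowIdx k τ) ℂ}
    (h : Linv * cayley k n τ v I = 1) (z : Fin k → ℂ) :
    xiFun Linv z ᵥ* cayley k n τ v I = systemRhs z := by
  rw [xiFun_eq_vecMul, Matrix.vecMul_vecMul, h, Matrix.vecMul_one]

/-- The `s`-column of the system determines `ξ` on the row of `y_{2μ-1} s_μ`. -/
lemma xiFun_slack {k n : ℕ} {τ : Fin k → ℕ} {v : (ν : Fin k) → Fin (τ ν) → Fin n → ℤ}
    {I : Fin k → Finset (Fin n)} {Linv : Matrix (ColIdx k n) (RowIdx k τ) ℂ}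
    (h : Linv * cayley k n τ v I = 1) (z : Fin k → ℂ) (μ : Fin k) :
    xiFun Linv z (Sum.inr (μ, 0)) = z μ := by
  have key := congrFun (xiFun_vecMul_cayley h z) (Sum.inr (Sum.inr μ))
  simpa [Matrix.vecMul, dotProduct, Fintype.sum_sum_type, cayley, systemRhs,
    Fintype.sum_prod_type, Fin.sum_univ_three] using key

/-- The `y_{2μ-1}`-column of the system: the weights `ξ` of the `μ`-th block sum to `1 - z_μ`. -/
lemma sum_xiFun_block {k n : ℕ} {τ : Fin k → ℕ} {v : (ν : Fin k) → Fin (τ ν) → Fin n → ℤ}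
    {I : Fin k → Finset (Fin n)} {Linv : Matrix (ColIdx k n) (RowIdx k τ) ℂ}
    (h : Linv * cayley k n τ v I = 1) (z : Fin k → ℂ) (μ : Fin k) :
    ∑ σ : MonIdx k τ, (if σ.1 = μ then xiFun Linv z (Sum.inl σ) else 0) = 1 - z μ := by
  have key := congrFun (xiFun_vecMul_cayley h z) (Sum.inr (Sum.inl (μ, 0)))
  simp only [Matrix.vecMul, dotProduct, Fintype.sum_sum_type, cayley, systemRhs,
    Fintype.sum_prod_type, Fin.sum_univ_three] at key
  simp [xiFun_slack h] at key
  rw [← key]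
  simp [eq_comm]

lemma Complex.Gamma_mul_Gamma_one_sub_mul_sin {s : ℂ} (hs : ∀ m : ℤ, s ≠ m) :
    Complex.Gamma s * Complex.Gamma (1 - s) * Complex.sin (Real.pi * (1 - s)) = Real.pi := by
  have hsin : Complex.sin (Real.pi * s) ≠ 0 := by
    rw [Complex.sin_ne_zero_iff]
    intro m hm
    refine hs m (mul_left_cancel₀ (Complex.ofReal_ne_zero.mpr Real.pi_ne_zero) ?_)
    rw [hm, mul_comm]
  rw [Complex.Gamma_mul_Gamma_one_sub, mul_one_sub, Complex.sin_pi_sub, div_mul_cancel₀ _ hsin]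

/-- Theorem 3.1 / formula (3.12): with A_q(z) = Σ_ν ᵀQ_q^(ν) ξ^(ν)(z), one has
Π_q Γ(z_q)·Γ(A_q(z))·sin(π A_q(z)) = π^k, and consequently
Π_q Γ(z_q)·Π_{j∈I_Λ} Γ(ξ_j(z)) = π^k·Π_{j∈I_Λ} Γ(ξ_j(z)) / Π_q [Γ(A_q(z))·sin(π A_q(z))]. -/
theorem mellin_transform_weights_formula
    (k n : ℕ) (hk : 1 ≤ k) (τ : Fin k → ℕ) (hτ : ∀ ν, 1 ≤ τ ν)
    (hn : n = ∑ ν : Fin k, τ ν)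
    (v : (ν : Fin k) → Fin (τ ν) → Fin n → ℤ)
    (I : Fin k → Finset (Fin n))
    (hdisj : ∀ ν μ : Fin k, ν ≠ μ → Disjoint (I ν) (I μ))
    (hcover : ∀ j : Fin n, ∃ ν : Fin k, j ∈ I ν)
    (Linv : Matrix (ColIdx k n) (RowIdx k τ) ℂ)
    (hL₁ : cayley k n τ v I * Linv = 1)
    (hL₂ : Linv * cayley k n τ v I = 1)
    (M : Matrix (MonIdx k τ) (Fin n) ℂ)
    (hM₁ : (lamMat k n τ v)ᵀ * M = 1) (hM₂ : M * (lamMat k n τ v)ᵀ = 1)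
    (νp : Equiv.Perm (Fin k))
    (Tg : Fin k → MonIdx k τ → ℝ)
    (hTg : ∀ (q : Fin k) (σ : MonIdx k τ),
      (σ.1 = νp q → Tg q σ ≠ 0) ∧ (σ.1 ≠ νp q → Tg q σ = 0))
    (TV : Matrix (MonIdx k τ) (Fin k) ℝ)
    (xi' : Fin k → (Fin k → ℂ) → ℂ)
    (h310T : ∀ (z : Fin k → ℂ) (σ : MonIdx k τ),
      xiFun Linv z (Sum.inl σ)
        = ((Tg (νp.symm σ.1) σ : ℝ) : ℂ) * ∑ j : Fin k, ((TV σ j : ℝ) : ℂ) * xi' j z)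
    :
    ∀ z : Fin k → ℂ, (∀ q : Fin k, ∀ m : ℤ, z q ≠ (m : ℂ)) →
      (∏ q : Fin k,
          Complex.Gamma (z q)
            * Complex.Gamma (∑ j : Fin k, ((∑ σ : MonIdx k τ, Tg q σ * TV σ j : ℝ) : ℂ) * xi' j z)
            * Complex.sin ((Real.pi : ℂ)
                * ∑ j : Fin k, ((∑ σ : MonIdx k τ, Tg q σ * TV σ j : ℝ) : ℂ) * xi' j z))
        = (Real.pi : ℂ) ^ k ∧
      (∏ q : Fin k, Complex.Gamma (z q))
          * ∏ σ : MonIdx k τ, Complex.Gamma (xiFun Linv z (Sum.inl σ))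
        = (Real.pi : ℂ) ^ k
            * (∏ σ : MonIdx k τ, Complex.Gamma (xiFun Linv z (Sum.inl σ)))
            / ∏ q : Fin k,
                (Complex.Gamma (∑ j : Fin k, ((∑ σ : MonIdx k τ, Tg q σ * TV σ j : ℝ) : ℂ) * xi' j z)
                  * Complex.sin ((Real.pi : ℂ)
                      * ∑ j : Fin k, ((∑ σ : MonIdx k τ, Tg q σ * TV σ j : ℝ) : ℂ) * xi' j z)) := by
  intro z hz
  have hA : ∀ q : Fin k,
      (∑ j : Fin k, ((∑ σ : MonIdx k τ, Tg q σ * TV σ j : ℝ) : ℂ) * xi' j z) = 1 - z (νp q) := by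
    intro q
    rw [← sum_xiFun_block hL₂ z (νp q)]
    push_cast
    simp only [Finset.sum_mul]
    rw [Finset.sum_comm]
    refine Finset.sum_congr rfl fun σ _ => ?_
    split_ifs with hσ
    · rw [h310T z σ, hσ, Equiv.symm_apply_apply, Finset.mul_sum]
      simp only [mul_assoc]
    · simp [(hTg q σ).2 hσ]
  simp only [hA]
  have hprod : (∏ q : Fin k, Complex.Gamma (z q)) *
      ∏ q : Fin k, (Complex.Gamma (1 - z (νp q)) * Complex.sin (Real.pi * (1 - z (νp q))))
        = (Real.pi : ℂ) ^ k := by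
    rw [← Equiv.prod_comp νp fun q => Complex.Gamma (z q), ← Finset.prod_mul_distrib]
    simp [← mul_assoc, Complex.Gamma_mul_Gamma_one_sub_mul_sin (hz _)]
  have hpi : (Real.pi : ℂ) ^ k ≠ 0 := pow_ne_zero _ (Complex.ofReal_ne_zero.mpr Real.pi_ne_zero)
  refine ⟨?_, ?_⟩
  · rw [← hprod, ← Finset.prod_mul_distrib]
    simp only [mul_assoc]
  · rw [eq_div_iff (right_ne_zero_of_mul (hprod ▸ hpi)), mul_right_comm, hprod]
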